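/- arXiv:1909.00177 — 2 statements merged into one kernel-verified Lean document; each statement's English description precedes it below -/
import Mathlib

section
/- There is an absolute constant C > 0 with the following property: for every real number ε with 0 < ε ≤ 1, every K > 0, every holomorphic function g on Ω_ε with |g| ≤ K throughout Ω_ε, and every real number r > 0, one has ∫_{Ω_{ε/2}} |g′(z)|² · 1_{{|g(z)| < r}}(z) dλ(z) ≤ C (r²/ε³) ln(K²/r² + 1), where λ is Lebesgue measure on ℂ. -/
open Set Filter MeasureTheory Topology

/-- The open ellipse `Ω_ε = φ_ε(S)`, `φ_ε(z) = sin (ε z)`, `S = {|Im z| < 1}`. -/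
noncomputable def OmegaE (ε : ℝ) : Set ℂ :=
  (fun z => Complex.sin (ε * z)) '' {z : ℂ | |z.im| < 1}

theorem Continuous.integrable_mul_of_continuousAt_tsupport {φ u : ℂ → ℝ} (hφ : Continuous φ)
    (hc : HasCompactSupport φ) (hu : ∀ x ∈ tsupport φ, ContinuousAt u x) :
    Integrable fun x => φ x * u x := by
  refine Continuous.integrable_of_hasCompactSupport ?_ hc.mul_right
  refine continuous_of_tsupport fun x hx => ?_
  exact hφ.continuousAt.mul (hu x (tsupport_mul_subset_left hx))

/-- Second order integration by parts against a compactly supported smooth function. -/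
theorem integral_mul_fderiv_fderiv_apply {φ u : ℂ → ℝ} (hφ : ContDiff ℝ 2 φ)
    (hc : HasCompactSupport φ) (hu : ∀ x ∈ tsupport φ, ContDiffAt ℝ 2 u x) (e : ℂ) :
    ∫ x, φ x * fderiv ℝ (fun y => fderiv ℝ u y e) x e =
      ∫ x, fderiv ℝ (fun y => fderiv ℝ φ y e) x e * u x := by
  have hφ₁ : ContDiff ℝ 1 fun y => fderiv ℝ φ y e :=
    (hφ.fderiv_right (by norm_num)).clm_apply contDiff_const
  have hφ₂ : Continuous fun x => fderiv ℝ (fun y => fderiv ℝ φ y e) x e :=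
    (hφ₁.continuous_fderiv one_ne_zero).clm_apply continuous_const
  have hs₁ : tsupport (fun y => fderiv ℝ φ y e) ⊆ tsupport φ := tsupport_fderiv_apply_subset ℝ e
  have hs₂ := (tsupport_fderiv_apply_subset ℝ (f := fun y => fderiv ℝ φ y e) e).trans hs₁
  have hu₁ : ∀ x ∈ tsupport φ, ContDiffAt ℝ 1 (fun y => fderiv ℝ u y e) x := fun x hx =>
    ((hu x hx).fderiv_right (by norm_num)).clm_apply contDiffAt_const
  have hu₂ : ∀ x ∈ tsupport φ,
      ContinuousAt (fun x => fderiv ℝ (fun y => fderiv ℝ u y e) x e) x := fun x hx =>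
    (((hu₁ x hx).fderiv_right (m := 0) (by norm_num)).clm_apply contDiffAt_const).continuousAt
  have hc₁ := hc.fderiv_apply ℝ e
  have hc₂ := hc₁.fderiv_apply ℝ e
  have hi := hφ₁.continuous.integrable_mul_of_continuousAt_tsupport hc₁
    fun x hx => (hu₁ x (hs₁ hx)).continuousAt
  rw [integral_mul_fderiv_eq_neg_fderiv_mul_of_integrable hi
    (hφ.continuous.integrable_mul_of_continuousAt_tsupport hc hu₂)
    (hφ.continuous.integrable_mul_of_continuousAt_tsupport hc fun x hx => (hu₁ x hx).continuousAt)
    (fun x _ => hφ.differentiable two_ne_zero x)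
    (fun x hx => (hu₁ x hx).differentiableAt one_ne_zero),
    integral_mul_fderiv_eq_neg_fderiv_mul_of_integrable
    (hφ₂.integrable_mul_of_continuousAt_tsupport hc₂ fun x hx => (hu x (hs₂ hx)).continuousAt) hi
    (hφ₁.continuous.integrable_mul_of_continuousAt_tsupport hc₁
      fun x hx => (hu x (hs₁ hx)).continuousAt)
    (fun x _ => hφ₁.differentiable one_ne_zero x)
    (fun x hx => (hu x (hs₁ hx)).differentiableAt two_ne_zero), neg_neg]

theorem HasDerivAt.hasFDerivAt_log_one_add_norm_sq {h : ℂ → ℂ} {h' z : ℂ}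
    (hh : HasDerivAt h h' z) :
    ∃ L : ℂ →L[ℝ] ℝ, HasFDerivAt (fun w => Real.log (1 + ‖h w‖ ^ 2)) L z ∧
      ∀ e, L e = 2 * ((starRingEnd ℂ) (h z) * h' * e).re / (1 + ‖h z‖ ^ 2) := by
  have h1 := ((hh.hasFDerivAt.restrictScalars ℝ).norm_sq.const_add 1).log
    (by positivity)
  refine ⟨_, h1, fun e => ?_⟩
  simp [Complex.inner]
  field_simp
  ring

theorem fderiv_fderiv_log_one_add_norm_sq {h : ℂ → ℂ} {z : ℂ} (hh : AnalyticAt ℂ h z) (e : ℂ) :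
    fderiv ℝ (fun y => fderiv ℝ (fun w => Real.log (1 + ‖h w‖ ^ 2)) y e) z e =
      2 * (‖deriv h z * e‖ ^ 2 + ((starRingEnd ℂ) (h z) * deriv (deriv h) z * e ^ 2).re) /
        (1 + ‖h z‖ ^ 2) -
      4 * ((starRingEnd ℂ) (h z) * deriv h z * e).re ^ 2 / (1 + ‖h z‖ ^ 2) ^ 2 := by
  have hev : (fun y => fderiv ℝ (fun w => Real.log (1 + ‖h w‖ ^ 2)) y e) =ᶠ[𝓝 z]
      fun y => 2 * inner ℝ (h y) (deriv h y * e) / (1 + ‖h y‖ ^ 2) := by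
    filter_upwards [hh.eventually_analyticAt] with y hy
    obtain ⟨L, hL, hLe⟩ := hy.differentiableAt.hasDerivAt.hasFDerivAt_log_one_add_norm_sq
    rw [hL.fderiv, hLe, Complex.inner]
    ring_nf
  rw [hev.fderiv_eq]
  have h1 := hh.differentiableAt.hasDerivAt.hasFDerivAt.restrictScalars ℝ
  have h2 := (hh.deriv.differentiableAt.hasDerivAt.mul_const e).hasFDerivAt.restrictScalars ℝ
  have hne : 1 + ‖h z‖ ^ 2 ≠ 0 := by positivity
  have h3 := ((h1.inner ℝ h2).const_mul 2).fun_mul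
    ((hasDerivAt_inv hne).comp_hasFDerivAt z (h1.norm_sq.const_add 1))
  simp only [Function.comp_def, ← div_eq_mul_inv] at h3
  rw [h3.fderiv]
  rw [← Complex.normSq_eq_norm_sq (deriv h z * e)]
  simp [Complex.inner, Complex.normSq_apply, pow_two]
  field_simp
  ring

theorem laplacian_log_one_add_norm_sq {h : ℂ → ℂ} {z : ℂ} (hh : AnalyticAt ℂ h z) :
    fderiv ℝ (fun y => fderiv ℝ (fun w => Real.log (1 + ‖h w‖ ^ 2)) y 1) z 1 +
      fderiv ℝ (fun y => fderiv ℝ (fun w => Real.log (1 + ‖h w‖ ^ 2)) y Complex.I) z Complex.I =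
      4 * ‖deriv h z‖ ^ 2 / (1 + ‖h z‖ ^ 2) ^ 2 := by
  rw [fderiv_fderiv_log_one_add_norm_sq hh, fderiv_fderiv_log_one_add_norm_sq hh]
  have hn := Complex.normSq_eq_norm_sq ((starRingEnd ℂ) (h z) * deriv h z)
  rw [norm_mul, RCLike.norm_conj, mul_pow, Complex.normSq_apply] at hn
  have hp : 1 + ‖h z‖ ^ 2 ≠ 0 := by positivity
  simp only [mul_one, one_pow, Complex.I_sq, norm_mul, Complex.norm_I, mul_neg, Complex.neg_re,
    Complex.mul_I_re]
  field_simp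
  linear_combination -4 * hn

/-- On the half-size disc, `|h′|²` restricted to `{|h| < 1}` has a majorant with integral
`O(log (Q² + 1))`: a cutoff of `Δ log (1 + |h|²) = 4 |h′|² / (1 + |h|²)²`. -/
theorem exists_majorant_unit_disc :
    ∃ C > 0, ∀ h : ℂ → ℂ, DifferentiableOn ℂ h (Metric.ball 0 1) → ∀ Q : ℝ,
      (∀ z ∈ Metric.ball 0 1, ‖h z‖ ≤ Q) →
      ∃ M : ℂ → ℝ, Integrable M ∧ (∀ z, 0 ≤ M z) ∧
        (∀ z ∈ Metric.closedBall 0 (1 / 2), ‖h z‖ < 1 → ‖deriv h z‖ ^ 2 ≤ M z) ∧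
        ∫ z, M z ≤ C * Real.log (Q ^ 2 + 1) := by
  let χ : ContDiffBump (0 : ℂ) := ⟨1 / 2, 3 / 4, by norm_num, by norm_num⟩
  have hχ : ContDiff ℝ 2 χ := χ.contDiff
  have hsub : tsupport χ ⊆ Metric.ball 0 1 := by
    rw [χ.tsupport_eq]
    exact Metric.closedBall_subset_ball (by norm_num [χ])
  let D : ℂ → ℂ → ℝ := fun e x => fderiv ℝ (fun y => fderiv ℝ χ y e) x e
  have hDc : ∀ e, Continuous (D e) := fun e =>
    (((hχ.fderiv_right (m := 1) (by norm_num)).clm_apply contDiff_const).continuous_fderiv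
      one_ne_zero).clm_apply continuous_const
  have hDs : ∀ e, HasCompactSupport (D e) := fun e =>
    (χ.hasCompactSupport.fderiv_apply ℝ e).fderiv_apply ℝ e
  have hDt : ∀ e, tsupport (D e) ⊆ tsupport χ := fun e =>
    (tsupport_fderiv_apply_subset ℝ (f := fun y => fderiv ℝ χ y e) e).trans
      (tsupport_fderiv_apply_subset ℝ e)
  have hDi : ∀ e, Integrable fun x => |D e x| := fun e =>
    ((hDc e).integrable_of_hasCompactSupport (hDs e)).abs
  refine ⟨(∫ x, (|D 1 x| + |D Complex.I x|)) + 1, ?_, fun h hh Q hQ => ?_⟩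
  · have : 0 ≤ ∫ x, (|D 1 x| + |D Complex.I x|) := integral_nonneg fun x => by positivity
    positivity
  have han : ∀ x ∈ Metric.ball (0 : ℂ) 1, AnalyticAt ℂ h x := fun x hx =>
    hh.analyticAt (Metric.isOpen_ball.mem_nhds hx)
  set u : ℂ → ℝ := fun w => Real.log (1 + ‖h w‖ ^ 2)
  have hu : ∀ x ∈ tsupport χ, ContDiffAt ℝ 2 u x := fun x hx => by
    have h1 : ContDiffAt ℝ 2 h x := (han x (hsub hx)).contDiffAt.restrict_scalars ℝ
    exact (contDiffAt_const.add (h1.norm_sq ℝ)).log (by positivity)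
  have hu₂ : ∀ e, ∀ x ∈ tsupport χ,
      ContinuousAt (fun x => fderiv ℝ (fun y => fderiv ℝ u y e) x e) x := fun e x hx =>
    (((((hu x hx).fderiv_right (m := 1) (by norm_num)).clm_apply
      contDiffAt_const).fderiv_right (m := 0) (by norm_num)).clm_apply
      contDiffAt_const).continuousAt
  have hi : ∀ e, Integrable fun x => χ x * fderiv ℝ (fun y => fderiv ℝ u y e) x e := fun e =>
    hχ.continuous.integrable_mul_of_continuousAt_tsupport χ.hasCompactSupport (hu₂ e)
  have hDu : ∀ e, Integrable fun x => D e x * u x := fun e =>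
    (hDc e).integrable_mul_of_continuousAt_tsupport (hDs e)
      fun x hx => (hu x (hDt e hx)).continuousAt
  have hM : (fun z => χ z * (4 * ‖deriv h z‖ ^ 2 / (1 + ‖h z‖ ^ 2) ^ 2)) = fun z =>
      χ z * fderiv ℝ (fun y => fderiv ℝ u y 1) z 1 +
        χ z * fderiv ℝ (fun y => fderiv ℝ u y Complex.I) z Complex.I := by
    funext z
    by_cases hz : z ∈ tsupport χ
    · rw [← laplacian_log_one_add_norm_sq (han z (hsub hz)), mul_add]
    · simp [image_eq_zero_of_notMem_tsupport hz]
  refine ⟨fun z => χ z * (4 * ‖deriv h z‖ ^ 2 / (1 + ‖h z‖ ^ 2) ^ 2), ?_, fun z => ?_,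
    fun z hz hz1 => ?_, ?_⟩
  · rw [hM]
    exact (hi 1).add (hi Complex.I)
  · have := χ.nonneg' z
    positivity
  · simp only
    rw [χ.one_of_mem_closedBall hz, one_mul, le_div_iff₀ (by positivity), mul_comm]
    gcongr
    have : ‖h z‖ ^ 2 ≤ 1 := pow_le_one₀ (norm_nonneg _) hz1.le
    nlinarith [sq_nonneg ‖h z‖]
  have hL : 0 ≤ Real.log (Q ^ 2 + 1) := Real.log_nonneg (by nlinarith)
  have hbound : ∀ e x, D e x * u x ≤ |D e x| * Real.log (Q ^ 2 + 1) := fun e x => by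
    by_cases hx : x ∈ tsupport (D e)
    · have h1 := hQ x (hsub (hDt e hx))
      have h2 : 0 ≤ u x := Real.log_nonneg (by nlinarith [sq_nonneg ‖h x‖])
      have h3 : u x ≤ Real.log (Q ^ 2 + 1) := by
        refine Real.log_le_log (by positivity) ?_
        rw [add_comm]
        gcongr
      exact (mul_le_mul_of_nonneg_right (le_abs_self _) h2).trans
        (mul_le_mul_of_nonneg_left h3 (abs_nonneg _))
    · simp [image_eq_zero_of_notMem_tsupport hx]
  rw [hM, integral_add (hi 1) (hi Complex.I),
    integral_mul_fderiv_fderiv_apply hχ χ.hasCompactSupport hu,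
    integral_mul_fderiv_fderiv_apply hχ χ.hasCompactSupport hu,
    integral_add (hDi _) (hDi _), add_mul, add_mul, one_mul, ← integral_mul_const,
    ← integral_mul_const]
  have h1 := integral_mono (hDu 1) ((hDi 1).mul_const _) (hbound 1)
  have h2 := integral_mono (hDu Complex.I) ((hDi Complex.I).mul_const _) (hbound Complex.I)
  simp only [D] at h1 h2 ⊢
  linarith

theorem Complex.sin_re_eq (u : ℂ) : (Complex.sin u).re = Real.sin u.re * Real.cosh u.im := by
  rw [Complex.sin_eq, ← Complex.ofReal_sin, ← Complex.ofReal_cos, ← Complex.ofReal_sinh,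
    ← Complex.ofReal_cosh, Complex.add_re, Complex.mul_I_re, ← Complex.ofReal_mul,
    ← Complex.ofReal_mul, Complex.ofReal_re, Complex.ofReal_im, neg_zero, add_zero]

theorem Complex.sin_im_eq (u : ℂ) : (Complex.sin u).im = Real.cos u.re * Real.sinh u.im := by
  rw [Complex.sin_eq, ← Complex.ofReal_sin, ← Complex.ofReal_cos, ← Complex.ofReal_sinh,
    ← Complex.ofReal_cosh, Complex.add_im, Complex.mul_I_im, ← Complex.ofReal_mul,
    ← Complex.ofReal_mul, Complex.ofReal_re, Complex.ofReal_im, zero_add]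

theorem Complex.norm_sin_sub_one_add_norm_sin_add_one (u : ℂ) :
    ‖Complex.sin u - 1‖ + ‖Complex.sin u + 1‖ = 2 * Real.cosh u.im := by
  have h1 := Real.sin_sq_add_cos_sq u.re
  have h2 := Real.cosh_sq u.im
  have h3 := Real.one_le_cosh u.im
  have hm : ‖Complex.sin u - 1‖ = Real.cosh u.im - Real.sin u.re := by
    rw [← sq_eq_sq₀ (norm_nonneg _) (by linarith [Real.sin_le_one u.re]),
      ← Complex.normSq_eq_norm_sq, Complex.normSq_apply]
    simp only [Complex.sub_re, Complex.sub_im, Complex.one_re, Complex.one_im,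
      Complex.sin_re_eq, Complex.sin_im_eq]
    linear_combination (1 - Real.cosh u.im ^ 2) * (-h1) - Real.cos u.re ^ 2 * h2
  have hp : ‖Complex.sin u + 1‖ = Real.cosh u.im + Real.sin u.re := by
    rw [← sq_eq_sq₀ (norm_nonneg _) (by linarith [Real.neg_one_le_sin u.re]),
      ← Complex.normSq_eq_norm_sq, Complex.normSq_apply]
    simp only [Complex.add_re, Complex.add_im, Complex.one_re, Complex.one_im,
      Complex.sin_re_eq, Complex.sin_im_eq]
    linear_combination (1 - Real.cosh u.im ^ 2) * (-h1) - Real.cos u.re ^ 2 * h2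
  rw [hm, hp]
  ring

theorem mem_OmegaE_iff {ε : ℝ} (hε : 0 < ε) {w : ℂ} :
    w ∈ OmegaE ε ↔ ‖w - 1‖ + ‖w + 1‖ < 2 * Real.cosh ε := by
  constructor
  · rintro ⟨z, hz, rfl⟩
    have hz : |z.im| < 1 := hz
    simp only [Complex.norm_sin_sub_one_add_norm_sin_add_one]
    rw [mul_lt_mul_iff_right₀ two_pos, Real.cosh_lt_cosh, Complex.im_ofReal_mul, abs_mul,
      abs_of_pos hε]
    nlinarith
  · intro h
    obtain ⟨u, rfl⟩ := Complex.sin_surjective w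
    rw [Complex.norm_sin_sub_one_add_norm_sin_add_one, mul_lt_mul_iff_right₀ two_pos,
      Real.cosh_lt_cosh, abs_of_pos hε] at h
    have hε' : (ε : ℂ) ≠ 0 := by exact_mod_cast hε.ne'
    refine ⟨(ε⁻¹ : ℝ) * u, ?_, ?_⟩
    · rw [mem_ofPred_eq, Complex.im_ofReal_mul, abs_mul, abs_of_pos (inv_pos.2 hε)]
      exact (inv_mul_lt_one₀ hε).2 h
    · simp only [Complex.ofReal_inv]
      rw [mul_inv_cancel_left₀ hε']

theorem isOpen_OmegaE {ε : ℝ} (hε : 0 < ε) : IsOpen (OmegaE ε) := by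
  have : OmegaE ε = {w : ℂ | ‖w - 1‖ + ‖w + 1‖ < 2 * Real.cosh ε} := by
    ext w
    exact mem_OmegaE_iff hε
  rw [this]
  exact isOpen_lt (by fun_prop) continuous_const

theorem three_eighths_sq_le_cosh_sub_cosh_half {ε : ℝ} (hε : 0 < ε) :
    3 / 8 * ε ^ 2 ≤ Real.cosh ε - Real.cosh (ε / 2) := by
  have h1 : Real.cosh ε = 2 * Real.cosh (ε / 2) ^ 2 - 1 := by
    have := Real.cosh_two_mul (ε / 2)
    rw [mul_div_cancel₀ _ two_ne_zero] at this
    linarith [Real.cosh_sq (ε / 2)]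
  have h2 : Real.cosh (ε / 2) = 1 + 2 * Real.sinh (ε / 4) ^ 2 := by
    have := Real.cosh_two_mul (ε / 4)
    rw [show 2 * (ε / 4) = ε / 2 by ring] at this
    linarith [Real.cosh_sq (ε / 4)]
  have h3 : ε / 4 ≤ Real.sinh (ε / 4) := Real.self_le_sinh_iff.2 (by positivity)
  have h4 : (ε / 4) ^ 2 ≤ Real.sinh (ε / 4) ^ 2 := by gcongr
  rw [h1, h2]
  nlinarith [sq_nonneg (Real.sinh (ε / 4) ^ 2)]

theorem mem_OmegaE_of_norm_sub_lt {ε : ℝ} (hε : 0 < ε) {z w : ℂ} (hz : z ∈ OmegaE (ε / 2))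
    (hw : ‖w - z‖ < 3 / 8 * ε ^ 2) : w ∈ OmegaE ε := by
  rw [mem_OmegaE_iff (by positivity)] at hz ⊢
  have h1 := norm_add_le (w - z) (z - 1)
  have h2 := norm_add_le (w - z) (z + 1)
  rw [show w - z + (z - 1) = w - 1 by ring] at h1
  rw [show w - z + (z + 1) = w + 1 by ring] at h2
  linarith [three_eighths_sq_le_cosh_sub_cosh_half hε]

theorem abs_re_le_and_abs_im_le_of_mem_OmegaE_half {ε : ℝ} (hε : 0 < ε) (hε1 : ε ≤ 1) {z : ℂ}
    (hz : z ∈ OmegaE (ε / 2)) : |z.re| ≤ 2 ∧ |z.im| ≤ ε := by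
  obtain ⟨ζ, hζ, rfl⟩ := hz
  have hζ : |ζ.im| < 1 := hζ
  set b : ℝ := ε / 2 * ζ.im with hb_def
  have hb : b ^ 2 ≤ ε ^ 2 / 4 := by
    have : ζ.im ^ 2 ≤ 1 := (sq_le_one_iff_abs_le_one _).2 hζ.le
    rw [hb_def]
    nlinarith [sq_nonneg ε]
  have hcosh : Real.cosh b ^ 2 ≤ 1 + 2 * b ^ 2 := by
    have h1 : Real.cosh b ^ 2 ≤ Real.exp (b ^ 2 / 2) ^ 2 := by
      gcongr
      exact Real.cosh_le_exp_half_sq b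
    rw [← Real.exp_nat_mul, Nat.cast_ofNat, mul_div_cancel₀ _ two_ne_zero] at h1
    have h2 := Real.abs_exp_sub_one_le (x := b ^ 2) (by rw [abs_of_nonneg (sq_nonneg b)]; nlinarith)
    rw [abs_of_nonneg (sq_nonneg b)] at h2
    linarith [le_abs_self (Real.exp (b ^ 2) - 1)]
  have hsinh := Real.cosh_sq b
  have hu : ((ε / 2 : ℝ) * ζ : ℂ).im = b := Complex.im_ofReal_mul _ _
  have hpy := Real.sin_sq_add_cos_sq ((ε / 2 : ℝ) * ζ : ℂ).re
  constructor
  · refine abs_le_of_sq_le_sq ?_ two_pos.le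
    simp only
    rw [Complex.sin_re_eq, hu]
    nlinarith [sq_nonneg (Real.cos ((ε / 2 : ℝ) * ζ : ℂ).re), sq_nonneg (Real.cosh b)]
  · refine abs_le_of_sq_le_sq ?_ hε.le
    simp only
    rw [Complex.sin_im_eq, hu]
    nlinarith [sq_nonneg (Real.sin ((ε / 2 : ℝ) * ζ : ℂ).re), sq_nonneg (Real.sinh b)]

theorem exists_majorant_disc :
    ∃ C > 0, ∀ (c : ℂ) (δ : ℝ), 0 < δ → ∀ g : ℂ → ℂ, DifferentiableOn ℂ g (Metric.ball c δ) →
      ∀ K : ℝ, (∀ z ∈ Metric.ball c δ, ‖g z‖ ≤ K) → ∀ r : ℝ, 0 < r →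
      ∃ M : ℂ → ℝ, Integrable M ∧ (∀ z, 0 ≤ M z) ∧
        (∀ z ∈ Metric.closedBall c (δ / 2), ‖g z‖ < r → ‖deriv g z‖ ^ 2 ≤ M z) ∧
        ∫ z, M z ≤ C * r ^ 2 * Real.log (K ^ 2 / r ^ 2 + 1) := by
  obtain ⟨C, hC, hmaj⟩ := exists_majorant_unit_disc
  refine ⟨C, hC, fun c δ hδ g hg K hK r hr => ?_⟩
  have hδ' : (δ : ℂ) ≠ 0 := by exact_mod_cast hδ.ne'
  have hr' : (r : ℂ) ≠ 0 := by exact_mod_cast hr.ne'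
  have hmaps : ∀ ζ ∈ Metric.ball (0 : ℂ) 1, c + δ * ζ ∈ Metric.ball c δ := fun ζ hζ => by
    rw [mem_ball_zero_iff] at hζ
    rw [mem_ball_iff_norm, add_sub_cancel_left, norm_mul, Complex.norm_of_nonneg hδ.le]
    nlinarith
  have hd : ∀ ζ ∈ Metric.ball (0 : ℂ) 1,
      HasDerivAt (fun ζ => g (c + δ * ζ) / r) (deriv g (c + δ * ζ) * δ / r) ζ := fun ζ hζ => by
    have h1 := (hg.differentiableAt (Metric.isOpen_ball.mem_nhds (hmaps ζ hζ))).hasDerivAt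
    have h2 : HasDerivAt (fun ζ : ℂ => c + δ * ζ) δ ζ := by
      simpa using ((hasDerivAt_id ζ).const_mul (δ : ℂ)).const_add c
    exact (h1.comp ζ h2).div_const _
  obtain ⟨M, hMi, hM0, hMle, hMint⟩ := hmaj (fun ζ => g (c + δ * ζ) / r)
    (fun ζ hζ => (hd ζ hζ).differentiableAt.differentiableWithinAt) (K / r) fun ζ hζ => by
      rw [norm_div, Complex.norm_of_nonneg hr.le]
      exact div_le_div_of_nonneg_right (hK _ (hmaps ζ hζ)) hr.le
  refine ⟨fun z => r ^ 2 / δ ^ 2 * M (δ⁻¹ • (z - c)), ?_, fun z => ?_, fun z hz hgz => ?_, ?_⟩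
  · exact ((hMi.comp_smul (inv_ne_zero hδ.ne')).comp_sub_right c).const_mul _
  · exact mul_nonneg (by positivity) (hM0 _)
  · have hζn : ‖δ⁻¹ • (z - c)‖ ≤ 1 / 2 := by
      rw [mem_closedBall_iff_norm] at hz
      rw [norm_smul, Real.norm_of_nonneg (by positivity), inv_mul_le_iff₀ hδ]
      linarith
    have hcz : c + δ * (δ⁻¹ • (z - c)) = z := by
      rw [Complex.real_smul, Complex.ofReal_inv, mul_inv_cancel_left₀ hδ']
      ring
    have h1 := hMle (δ⁻¹ • (z - c)) (mem_closedBall_zero_iff.2 hζn)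
    rw [(hd _ (mem_ball_zero_iff.2 (by linarith))).deriv, hcz, norm_div, norm_div, norm_mul,
      Complex.norm_of_nonneg hr.le, Complex.norm_of_nonneg hδ.le] at h1
    have h2 := h1 ((div_lt_one hr).2 hgz)
    calc ‖deriv g z‖ ^ 2 = r ^ 2 / δ ^ 2 * (‖deriv g z‖ * δ / r) ^ 2 := by field_simp
      _ ≤ _ := mul_le_mul_of_nonneg_left h2 (by positivity)
  · rw [integral_const_mul, integral_sub_right_eq_self (fun z => M (δ⁻¹ • z)) c,
      Measure.integral_comp_inv_smul, Complex.finrank_real_complex, smul_eq_mul,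
      abs_of_nonneg (sq_nonneg δ)]
    rw [div_pow] at hMint
    calc r ^ 2 / δ ^ 2 * (δ ^ 2 * ∫ z, M z) = r ^ 2 * ∫ z, M z := by field_simp
      _ ≤ r ^ 2 * (C * Real.log (K ^ 2 / r ^ 2 + 1)) := by gcongr
      _ = _ := by ring

theorem Int.card_Icc_neg_floor_le {x : ℝ} (hx : 0 ≤ x) :
    ((Finset.Icc (-⌊x⌋) ⌊x⌋).card : ℝ) ≤ 2 * x + 1 := by
  have h0 : 0 ≤ ⌊x⌋ := Int.floor_nonneg.2 hx
  rw [Int.card_Icc, ← Int.cast_natCast, Int.toNat_of_nonneg (by lia)]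
  push_cast
  linarith [Int.floor_le x]

/-- `Ω_{ε/2}` is covered by `O(ε⁻³)` discs whose concentric doubles lie in `Ω_ε`. -/
theorem exists_finset_cover_OmegaE_half {ε : ℝ} (hε : 0 < ε) (hε1 : ε ≤ 1) :
    ∃ (s : Finset (ℤ × ℤ)) (c : ℤ × ℤ → ℂ) (δ : ℝ), 0 < δ ∧ (s.card : ℝ) ≤ 665 / ε ^ 3 ∧
      (∀ p ∈ s, Metric.ball (c p) δ ⊆ OmegaE ε) ∧
      ∀ z ∈ OmegaE (ε / 2), ∃ p ∈ s, z ∈ Metric.closedBall (c p) (δ / 2) := by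
  classical
  set a : ℝ := ε ^ 2 / 8 with ha_def
  have ha : 0 < a := by positivity
  let c : ℤ × ℤ → ℂ := fun p => ⟨a * p.1, a * p.2⟩
  let A : ℝ := 16 / ε ^ 2 + 1
  let B : ℝ := 8 / ε + 1
  refine ⟨{p ∈ Finset.Icc (-⌊A⌋) ⌊A⌋ ×ˢ Finset.Icc (-⌊B⌋) ⌊B⌋ |
    ∃ z ∈ OmegaE (ε / 2), z ∈ Metric.closedBall (c p) a}, c, 2 * a, by positivity, ?_, ?_, ?_⟩
  · have hA : 2 * A + 1 ≤ 35 / ε ^ 2 := by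
      rw [le_div_iff₀ (by positivity)]
      simp only [A]
      field_simp
      nlinarith
    have hB : 2 * B + 1 ≤ 19 / ε := by
      rw [le_div_iff₀ (by positivity)]
      simp only [B]
      field_simp
      nlinarith
    calc _ ≤ (((Finset.Icc (-⌊A⌋) ⌊A⌋ ×ˢ Finset.Icc (-⌊B⌋) ⌊B⌋).card : ℕ) : ℝ) := by
          exact_mod_cast Finset.card_filter_le _ _
      _ ≤ 35 / ε ^ 2 * (19 / ε) := by
          rw [Finset.card_product, Nat.cast_mul]
          gcongr
          · exact (Int.card_Icc_neg_floor_le (by positivity)).trans hA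
          · exact (Int.card_Icc_neg_floor_le (by positivity)).trans hB
      _ = 665 / ε ^ 3 := by
          field_simp
          norm_num
  · intro p hp w hw
    obtain ⟨-, z, hz, hzc⟩ := Finset.mem_filter.1 hp
    refine mem_OmegaE_of_norm_sub_lt hε hz ?_
    rw [← dist_eq_norm]
    rw [Metric.mem_ball] at hw
    rw [Metric.mem_closedBall] at hzc
    have := dist_triangle_right w z (c p)
    linarith
  · intro z hz
    obtain ⟨hre, him⟩ := abs_re_le_and_abs_im_le_of_mem_OmegaE_half hε hε1 hz
    have hround : ∀ x : ℝ, |x - a * round (x / a)| ≤ a / 2 := fun x => by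
      have h1 := abs_sub_round (x / a)
      rw [show x - a * round (x / a) = a * (x / a - round (x / a)) by field_simp, abs_mul,
        abs_of_pos ha]
      nlinarith
    have hmem : ∀ x y R : ℝ, |x| ≤ y → y / a + 1 ≤ R → round (x / a) ∈ Finset.Icc (-⌊R⌋) ⌊R⌋ :=
      fun x y R hx hR => by
        have h1 := abs_le.1 (abs_sub_round (x / a))
        have h2 : |x / a| ≤ y / a := by
          rw [abs_div, abs_of_pos ha]
          gcongr
        have h3 := abs_le.1 h2
        rw [Finset.mem_Icc, neg_le]
        constructor <;> rw [Int.le_floor] <;> push_cast <;> linarith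
    have hzc : z ∈ Metric.closedBall (c (round (z.re / a), round (z.im / a))) a := by
      rw [mem_closedBall_iff_norm]
      refine (Complex.norm_le_abs_re_add_abs_im _).trans ?_
      have h1 := hround z.re
      have h2 := hround z.im
      simp only [Complex.sub_re, Complex.sub_im, c]
      linarith
    refine ⟨(round (z.re / a), round (z.im / a)), ?_, by rwa [mul_div_cancel_left₀ _ two_ne_zero]⟩
    refine Finset.mem_filter.2 ⟨Finset.mem_product.2 ⟨hmem _ _ _ hre ?_, hmem _ _ _ him ?_⟩,
      z, hz, hzc⟩
    · refine le_of_eq ?_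
      simp only [A, a]
      field_simp
      norm_num
    · refine le_of_eq ?_
      simp only [B, a]
      field_simp

/-- There is an absolute constant `C > 0` such that for every `0 < ε ≤ 1`, every
holomorphic `g` on `Ω_ε` with `|g| ≤ K`, and every `r > 0`,
`∫_{Ω_{ε/2}} |g′|² 1_{|g| < r} dλ ≤ C (r²/ε³) ln(K²/r² + 1)`. -/
theorem l2_estimate_small_values :
    ∃ C > 0, ∀ ε : ℝ, 0 < ε → ε ≤ 1 → ∀ K : ℝ, 0 < K → ∀ g : ℂ → ℂ,
      DifferentiableOn ℂ g (OmegaE ε) → (∀ z ∈ OmegaE ε, ‖g z‖ ≤ K) →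
      ∀ r : ℝ, 0 < r →
        ∫ z in OmegaE (ε / 2),
            Set.indicator {z : ℂ | ‖g z‖ < r} (fun z => ‖deriv g z‖ ^ 2) z
          ≤ C * (r ^ 2 / ε ^ 3) * Real.log (K ^ 2 / r ^ 2 + 1) := by
  obtain ⟨C, hC, hmaj⟩ := exists_majorant_disc
  refine ⟨665 * C, by positivity, fun ε hε hε1 K hK g hg hgK r hr => ?_⟩
  obtain ⟨s, c, δ, hδ, hcard, hsub, hcov⟩ := exists_finset_cover_OmegaE_half hε hε1
  have hM : ∀ p ∈ s, ∃ M : ℂ → ℝ, Integrable M ∧ (∀ z, 0 ≤ M z) ∧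
      (∀ z ∈ Metric.closedBall (c p) (δ / 2), ‖g z‖ < r → ‖deriv g z‖ ^ 2 ≤ M z) ∧
      ∫ z, M z ≤ C * r ^ 2 * Real.log (K ^ 2 / r ^ 2 + 1) := fun p hp =>
    hmaj (c p) δ hδ g (hg.mono (hsub p hp)) K (fun z hz => hgK z (hsub p hp hz)) r hr
  choose! M hMi hM0 hMle hMint using hM
  have hL : 0 ≤ Real.log (K ^ 2 / r ^ 2 + 1) :=
    Real.log_nonneg (le_add_of_nonneg_left (by positivity))
  rw [← integral_indicator (isOpen_OmegaE (half_pos hε)).measurableSet]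
  calc _ ≤ ∫ z, ∑ p ∈ s, M p z := by
        refine integral_mono_of_nonneg (.of_forall fun z => ?_) (integrable_finsetSum s hMi)
          (.of_forall fun z => ?_)
        · exact indicator_nonneg (fun z _ => indicator_nonneg (fun z _ => by positivity) z) z
        · have hsum : 0 ≤ ∑ p ∈ s, M p z := Finset.sum_nonneg fun p hp => hM0 p hp z
          refine indicator_apply_le' (fun hz => indicator_apply_le' (fun hgz => ?_) fun _ => hsum)
            fun _ => hsum
          obtain ⟨p, hp, hzp⟩ := hcov z hz
          exact (hMle p hp z hzp hgz).trans
            (Finset.single_le_sum (f := fun p => M p z) (fun q hq => hM0 q hq z) hp)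
    _ = ∑ p ∈ s, ∫ z, M p z := integral_finsetSum s hMi
    _ ≤ s.card • (C * r ^ 2 * Real.log (K ^ 2 / r ^ 2 + 1)) := Finset.sum_le_card_nsmul _ _ _ hMint
    _ ≤ 665 / ε ^ 3 * (C * r ^ 2 * Real.log (K ^ 2 / r ^ 2 + 1)) := by
        rw [nsmul_eq_mul]
        gcongr
    _ = _ := by ring
end

section
/- Let M be a weight sequence satisfying the moderate growth condition, and let L, a₁, a₂ be positive real numbers. Then there exist positive numbers a₃ and a₄, depending only on L, a₁, a₂ and the sequence M, such that: for every ε > 0 and every function g that is holomorphic in Ω_ε and continuous on the closure of Ω_ε, if |g| ≤ L on Ω_ε and |g| ≤ a₁ h_M(a₂ ε) on the real interval [−1,1], then |g| ≤ a₃ h_M(a₄ ε) on Ω_{ε/2}. -/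
open Set Filter MeasureTheory Topology

/-- A weight sequence: positive, nondecreasing, `M 0 = 1`, logarithmically convex
(the sequence of ratios `M (j+1) / M j` is nondecreasing), and `M j ^ (1/j) → ∞`. -/
def IsWeightSeq (M : ℕ → ℝ) : Prop :=
  (∀ j, 0 < M j) ∧ Monotone M ∧ M 0 = 1 ∧
  (∀ j, M (j + 1) / M j ≤ M (j + 2) / M (j + 1)) ∧
  Tendsto (fun j : ℕ => (M j) ^ (1 / (j : ℝ))) atTop atTop

/-- The moderate growth condition. -/
def ModerateGrowth (M : ℕ → ℝ) : Prop :=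
  ∃ A > 0, ∀ j k : ℕ, M (j + k) ≤ A ^ (j + k) * (M j * M k)

/-- The strong non-quasianalyticity condition. -/
def StrongNQA (M : ℕ → ℝ) : Prop :=
  ∃ A > 0, ∀ k : ℕ, ∑' j : ℕ, M (k + j) / (((k + j : ℕ) + 1) * M ((k + j) + 1))
      ≤ A * (M k / M (k + 1))

/-- The function `h_M` associated with a weight sequence. -/
noncomputable def hFun (M : ℕ → ℝ) (t : ℝ) : ℝ :=
  if t = 0 then 0 else ⨅ j : ℕ, t ^ j * M j

lemma hFun_nonneg {M : ℕ → ℝ} (hM : ∀ j, 0 < M j) {t : ℝ} (ht : 0 ≤ t) : 0 ≤ hFun M t := by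
  unfold hFun
  split_ifs
  · exact le_rfl
  · exact Real.iInf_nonneg fun j => mul_nonneg (pow_nonneg ht j) (hM j).le

lemma hFun_le {M : ℕ → ℝ} (hM : ∀ j, 0 < M j) {t : ℝ} (ht : 0 < t) (j : ℕ) :
    hFun M t ≤ t ^ j * M j := by
  rw [hFun, if_neg ht.ne']
  exact ciInf_le ⟨0, by rintro _ ⟨k, rfl⟩; have := hM k; positivity⟩ j

lemma hFun_rpow_half_le {M : ℕ → ℝ} (hM : ∀ j, 0 < M j) {A : ℝ} (hA : 0 < A)
    (hMG : ∀ j k : ℕ, M (j + k) ≤ A ^ (j + k) * (M j * M k)) {t : ℝ} (ht : 0 < t) :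
    hFun M t ^ (1 / 2 : ℝ) ≤ hFun M (A * t) := by
  rw [hFun.eq_def M (A * t), if_neg (mul_pos hA ht).ne', ← Real.sqrt_eq_rpow]
  refine le_ciInf fun j => ?_
  have hj := hM j
  refine Real.sqrt_le_iff.2 ⟨by positivity, ?_⟩
  calc hFun M t ≤ t ^ (j + j) * M (j + j) := hFun_le hM ht _
    _ ≤ t ^ (j + j) * (A ^ (j + j) * (M j * M j)) := by gcongr; exact hMG j j
    _ = _ := by ring

lemma isOpen_abs_im_lt : IsOpen {z : ℂ | |z.im| < 1} :=
  isOpen_lt (by fun_prop) continuous_const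

lemma closure_abs_im_lt : {z : ℂ | |z.im| ≤ 1} ⊆ closure {z : ℂ | |z.im| < 1} := by
  have h : {z : ℂ | |z.im| < 1} = Complex.im ⁻¹' Ioo (-1) 1 := by
    ext z; simp [abs_lt]
  rw [h, Complex.closure_preimage_im, closure_Ioo (by norm_num)]
  intro z hz
  exact abs_le.1 hz

/-- The three lines theorem in one half of the strip, transported to the ellipse;
the unit `c = ±I` selects the half. -/
lemma norm_comp_sin_le {ε L δ : ℝ} {g : ℂ → ℂ}
    (hd : DifferentiableOn ℂ g (OmegaE ε)) (hc : ContinuousOn g (closure (OmegaE ε)))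
    (hb : ∀ z ∈ OmegaE ε, ‖g z‖ ≤ L) (hr : ∀ x : ℝ, x ∈ Icc (-1 : ℝ) 1 → ‖g (x : ℂ)‖ ≤ δ)
    {c : ℂ} (hcre : c.re = 0) (hcim : |c.im| = 1) {ζ : ℂ} (hζ : ζ.re ∈ Icc (0 : ℝ) 1) :
    ‖g (Complex.sin (ε * (c * ζ)))‖ ≤ δ ^ (1 - ζ.re) * L ^ ζ.re := by
  have him (z : ℂ) : |(c * z).im| = |z.re| := by simp [hcre, abs_mul, hcim]
  have hs : Continuous fun z : ℂ => Complex.sin (ε * z) := by fun_prop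
  have hmaps : ∀ z : ℂ, |z.im| ≤ 1 → Complex.sin (ε * z) ∈ closure (OmegaE ε) := fun z hz =>
    image_closure_subset_closure_image hs ⟨z, closure_abs_im_lt hz, rfl⟩
  have hb' : ∀ z ∈ closure (OmegaE ε), ‖g z‖ ≤ L := fun z hz =>
    closure_minimal (s := OmegaE ε) (t := {z | z ∈ closure (OmegaE ε) ∧ ‖g z‖ ≤ L})
      (fun w hw => ⟨subset_closure hw, hb w hw⟩)
      (isClosed_closure.isClosed_le hc.norm continuousOn_const) hz |>.2
  have hstrip : ∀ z ∈ Complex.HadamardThreeLines.verticalClosedStrip 0 1,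
      Complex.sin (ε * (c * z)) ∈ closure (OmegaE ε) := fun z hz =>
    hmaps _ (by rw [him, abs_of_nonneg hz.1]; exact hz.2)
  refine Complex.HadamardThreeLines.norm_le_interp_of_mem_verticalClosedStrip₀₁'
    (fun z => g (Complex.sin (ε * (c * z)))) hζ ⟨?_, ?_⟩ ?_ ?_ ?_
  · refine hd.comp (by fun_prop) fun z hz => ⟨c * z, ?_, rfl⟩
    change |(c * z).im| < 1
    rw [him, abs_of_pos hz.1]
    exact hz.2
  · refine hc.comp (by fun_prop) fun z hz => hstrip z ?_
    have : closure (Complex.HadamardThreeLines.verticalStrip 0 1) =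
        Complex.HadamardThreeLines.verticalClosedStrip 0 1 := by
      rw [Complex.HadamardThreeLines.verticalStrip, Complex.closure_preimage_re,
        closure_Ioo (by norm_num)]
      rfl
    rwa [← this]
  · refine ⟨L, ?_⟩
    rintro _ ⟨z, hz, rfl⟩
    exact hb' _ (hstrip z hz)
  · intro z hz
    have hz0 : z.re = 0 := hz
    have : c * z = ((c * z).re : ℂ) := by
      apply Complex.ext <;> simp [hcre, hz0]
    rw [this, ← Complex.ofReal_mul, ← Complex.ofReal_sin]
    exact hr _ ⟨Real.neg_one_le_sin _, Real.sin_le_one _⟩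
  · intro z hz
    have hz1 : z.re = 1 := hz
    exact hb' _ (hstrip z (by simp [Complex.HadamardThreeLines.verticalClosedStrip, hz1]))

lemma interpolation_le {L a h r : ℝ} (hL : 0 < L) (ha : 0 < a) (h0 : 0 ≤ h) (h1 : h ≤ 1)
    (hr0 : 0 ≤ r) (hr : r ≤ 1 / 2) :
    (a * h) ^ (1 - r) * L ^ r ≤ max a 1 * max L 1 * h ^ (1 / 2 : ℝ) := by
  have hA : a ^ (1 - r) ≤ max a 1 := by
    calc a ^ (1 - r) ≤ max a 1 ^ (1 - r) :=
          Real.rpow_le_rpow ha.le (le_max_left _ _) (by linarith)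
      _ ≤ max a 1 ^ (1 : ℝ) := Real.rpow_le_rpow_of_exponent_le (le_max_right _ _) (by linarith)
      _ = _ := Real.rpow_one _
  have hB : L ^ r ≤ max L 1 := by
    calc L ^ r ≤ max L 1 ^ r := Real.rpow_le_rpow hL.le (le_max_left _ _) hr0
      _ ≤ max L 1 ^ (1 : ℝ) := Real.rpow_le_rpow_of_exponent_le (le_max_right _ _) (by linarith)
      _ = _ := Real.rpow_one _
  have hC : h ^ (1 - r) ≤ h ^ (1 / 2 : ℝ) :=
    Real.rpow_le_rpow_of_exponent_ge_of_imp h0 h1 (by linarith) (by intros; linarith)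
  rw [Real.mul_rpow ha.le h0]
  calc a ^ (1 - r) * h ^ (1 - r) * L ^ r
      ≤ max a 1 * h ^ (1 / 2 : ℝ) * max L 1 := by gcongr
    _ = _ := by ring

/-- Three-lines-type lemma: if `M` has moderate growth, a bound `|g| ≤ L` on `Ω_ε`
together with the smallness `|g| ≤ a₁ h_M(a₂ ε)` on `[-1,1]` yields
`|g| ≤ a₃ h_M(a₄ ε)` on `Ω_{ε/2}`, with `a₃, a₄` depending only on `L, a₁, a₂, M`. -/
theorem smallness_propagation
    (M : ℕ → ℝ) (hM : IsWeightSeq M) (hMG : ModerateGrowth M)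
    (L a₁ a₂ : ℝ) (hL : 0 < L) (ha₁ : 0 < a₁) (ha₂ : 0 < a₂) :
    ∃ a₃ > 0, ∃ a₄ > 0, ∀ ε : ℝ, 0 < ε → ∀ g : ℂ → ℂ,
      DifferentiableOn ℂ g (OmegaE ε) → ContinuousOn g (closure (OmegaE ε)) →
      (∀ z ∈ OmegaE ε, ‖g z‖ ≤ L) →
      (∀ x : ℝ, x ∈ Icc (-1 : ℝ) 1 → ‖g (x : ℂ)‖ ≤ a₁ * hFun M (a₂ * ε)) →
      ∀ z ∈ OmegaE (ε / 2), ‖g z‖ ≤ a₃ * hFun M (a₄ * ε) := by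
  obtain ⟨hpos, -, hM0, -, -⟩ := hM
  obtain ⟨A, hA, hMG⟩ := hMG
  refine ⟨max a₁ 1 * max L 1, by positivity, A * a₂, by positivity, ?_⟩
  rintro ε hε g hd hc hb hr _ ⟨w, hw, rfl⟩
  have hw : |w.im| < 1 := hw
  have ht : 0 < a₂ * ε := by positivity
  have key : ∀ c : ℂ, c.re = 0 → |c.im| = 1 → ∀ ζ : ℂ, 0 ≤ ζ.re → ζ.re ≤ 1 / 2 →
      ‖g (Complex.sin (ε * (c * ζ)))‖ ≤ max a₁ 1 * max L 1 * hFun M (A * a₂ * ε) := by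
    intro c hcre hcim ζ h0 h1
    have hle : hFun M (a₂ * ε) ≤ 1 := by simpa [hM0] using hFun_le hpos ht 0
    refine (norm_comp_sin_le hd hc hb hr hcre hcim ⟨h0, by linarith⟩).trans
      ((interpolation_le hL ha₁ (hFun_nonneg hpos ht.le) hle h0 h1).trans ?_)
    rw [mul_assoc A]
    gcongr
    exact hFun_rpow_half_le hpos hA hMG ht
  have hw' := abs_lt.1 hw
  rcases le_total 0 w.im with h | h
  · convert key Complex.I (by simp) (by simp) (-Complex.I * (w / 2)) (by simp; linarith)
      (by simp; linarith) using 4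
    push_cast
    linear_combination ((ε : ℂ) * w / 2) * Complex.I_mul_I
  · convert key (-Complex.I) (by simp) (by simp) (Complex.I * (w / 2)) (by simp; linarith)
      (by simp; linarith) using 4
    push_cast
    linear_combination ((ε : ℂ) * w / 2) * Complex.I_mul_I
end
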